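/- arXiv:0908.3026 — 5 statements merged into one kernel-verified Lean document; each statement's English description precedes it below -/
import Mathlib

section
/- Let a < b be real numbers and let h : ℝ → ℝ be continuous on [a, b] with ∫ₐᵇ h(t) dt > 0. Then there exists a twice continuously differentiable function I : ℝ → ℝ with I'(a) = 0, I'(b) = 0, and h(t) − I''(t) > 0 for every t ∈ [a, b]. -/
/-- Existence of a correction function (end of Subsection 4.1): if h is continuous
on [a, b] with positive integral, there is a C² function I with I'(a) = I'(b) = 0
and h − I'' > 0 pointwise on [a, b]. -/
theorem exists_correction_function (a b : ℝ) (hab : a < b) (h : ℝ → ℝ)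
    (hc : ContinuousOn h (Set.Icc a b))
    (hint : 0 < ∫ t in a..b, h t) :
    ∃ I : ℝ → ℝ, ContDiff ℝ 2 I ∧ deriv I a = 0 ∧ deriv I b = 0 ∧
      ∀ t ∈ Set.Icc a b, 0 < h t - deriv (deriv I) t := by
  obtain ⟨g, hg, hgh⟩ : ∃ g : ℝ → ℝ, Continuous g ∧ ∀ t ∈ Set.Icc a b, g t = h t := by
    refine ⟨Set.IccExtend hab.le ((Set.Icc a b).restrict h), ?_, ?_⟩
    · exact (continuousOn_iff_continuous_restrict.1 hc).Icc_extend'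
    · intro t ht
      rw [Set.IccExtend_of_mem hab.le _ ht]
      rfl
  have hba : 0 < b - a := sub_pos.2 hab
  have hI : ∫ t in a..b, g t = ∫ t in a..b, h t := by
    apply intervalIntegral.integral_congr
    intro t ht
    rw [Set.uIcc_of_le hab.le] at ht
    exact hgh t ht
  set c : ℝ := (∫ t in a..b, h t) / (b - a) with hcdef
  have hcpos : 0 < c := div_pos hint hba
  let k : ℝ → ℝ := fun t => g t - c
  have hk : Continuous k := hg.sub continuous_const
  let F : ℝ → ℝ := fun x => ∫ t in a..x, k t
  have hF : ∀ x, HasDerivAt F (k x) x := fun x => hk.integral_hasStrictDerivAt a x |>.hasDerivAt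
  have hdF : deriv F = k := funext fun x => (hF x).deriv
  have hFc : Continuous F := continuous_iff_continuousAt.2 fun x => (hF x).continuousAt
  let J : ℝ → ℝ := fun x => ∫ t in a..x, F t
  have hJ : ∀ x, HasDerivAt J (F x) x := fun x => hFc.integral_hasStrictDerivAt a x |>.hasDerivAt
  have hdJ : deriv J = F := funext fun x => (hJ x).deriv
  have hF1 : ContDiff ℝ 1 F := by
    rw [contDiff_one_iff_deriv, hdF]
    exact ⟨fun x => (hF x).differentiableAt, hk⟩
  refine ⟨J, ?_, ?_, ?_, ?_⟩
  · rw [show (2 : WithTop ℕ∞) = 1 + 1 by norm_num, contDiff_succ_iff_deriv, hdJ]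
    exact ⟨fun x => (hJ x).differentiableAt, by simp, hF1⟩
  · rw [hdJ]
    simp [F]
  · rw [hdJ]
    change ∫ t in a..b, (g t - c) = 0
    rw [intervalIntegral.integral_sub (hg.intervalIntegrable _ _)
      (continuous_const.intervalIntegrable _ _), hI, intervalIntegral.integral_const, smul_eq_mul,
      hcdef, mul_div_cancel₀ _ hba.ne', sub_self]
  · intro t ht
    rw [hdJ, hdF]
    change 0 < h t - (g t - c)
    rw [hgh t ht]
    linarith
end

section
/- Let ρ, ν, l > 0, let ψ, φ : ℝ → ℝ be twice differentiable at t₀ with ψ(t₀) ≠ 0, and define Ψ(t) = ψ(t)/√(ρ²ψ(t)²/ν² + φ(t)⁴/(l²ψ(t)²) + 1) on a neighborhood of t₀ on which ψ ≠ 0. Then, writing u(t) = ψ'(t) − (2φ(t)³/l²)·(φ/ψ)'(t), the second derivative satisfies Ψ''(t₀) = ( ψ''(t₀) − (6φ(t₀)²φ'(t₀)/l²)·(φ/ψ)'(t₀) − (2φ(t₀)³/l²)·(φ/ψ)''(t₀) ) · Ψ(t₀)³/ψ(t₀)³ − 3 (ψ'(t₀)/ψ(t₀)) · u(t₀) ·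 Ψ(t₀)³/ψ(t₀)³ + 3 u(t₀)² · Ψ(t₀)⁵/ψ(t₀)⁶. -/
/-- First derivative: Ψ' = u Ψ³/ψ³, in terms of pointwise derivatives. -/
theorem cheeger_first_deriv (ρ ν l : ℝ) (hν : 0 < ν) (hl : 0 < l)
    (ψ φ : ℝ → ℝ) (t a b : ℝ) (hψ : HasDerivAt ψ a t) (hφ : HasDerivAt φ b t)
    (h0 : ψ t ≠ 0) (Ψ : ℝ → ℝ)
    (hΨ : ∀ t, Ψ t = ψ t / Real.sqrt (ρ^2 * (ψ t)^2 / ν^2 + (φ t)^4 / (l^2 * (ψ t)^2) + 1)) :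
    HasDerivAt Ψ ((a - (2 * (φ t)^3 / l^2) * ((b * ψ t - φ t * a) / (ψ t)^2))
      * (Ψ t)^3 / (ψ t)^3) t := by
  have hpos : 0 < ρ^2 * (ψ t)^2 / ν^2 + (φ t)^4 / (l^2 * (ψ t)^2) + 1 := by positivity
  have hfun : Ψ = fun t => ψ t / Real.sqrt
      (ρ^2 * (ψ t)^2 / ν^2 + (φ t)^4 / (l^2 * (ψ t)^2) + 1) := funext hΨ
  have hl2 : l^2 * (ψ t)^2 ≠ 0 := by positivity
  have hD : HasDerivAt (fun t => ρ^2 * (ψ t)^2 / ν^2 + (φ t)^4 / (l^2 * (ψ t)^2) + 1) _ t :=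
    ((((hψ.fun_pow 2).const_mul (ρ^2)).div_const (ν^2)).fun_add
      ((hφ.fun_pow 4).fun_div ((hψ.fun_pow 2).const_mul (l^2)) hl2)).add_const 1
  have hs := Real.sqrt_pos.mpr hpos
  have hq := hψ.fun_div (hD.sqrt hpos.ne') hs.ne'
  have hsq := Real.sq_sqrt hpos.le
  rw [hΨ t, hfun]
  refine hq.congr_deriv ?_
  generalize Real.sqrt (ρ^2 * (ψ t)^2 / ν^2 + (φ t)^4 / (l^2 * (ψ t)^2) + 1) = S at *
  have key : ∀ E : ℝ, (a * S - ψ t * (E / (2 * S))) / S^2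
      = (a * (ρ^2 * (ψ t)^2 / ν^2 + (φ t)^4 / (l^2 * (ψ t)^2) + 1) - ψ t * E / 2) / S^3 := by
    intro E
    rw [← hsq]
    field_simp
  rw [key]
  push_cast
  field_simp
  ring

/-- Proposition 7.3, second derivative formula for
Ψ = ψ/√(ρ²ψ²/ν² + φ⁴/(l²ψ²) + 1), with u = ψ' − (2φ³/l²)(φ/ψ)'. -/
theorem deriv2_cheeger_deformed_norm (ρ ν l : ℝ) (hρ : 0 < ρ) (hν : 0 < ν) (hl : 0 < l)
    (ψ φ : ℝ → ℝ) (t₀ : ℝ)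
    (hψ : ∀ᶠ t in nhds t₀, DifferentiableAt ℝ ψ t)
    (hψ' : DifferentiableAt ℝ (deriv ψ) t₀)
    (hφ : ∀ᶠ t in nhds t₀, DifferentiableAt ℝ φ t)
    (hφ' : DifferentiableAt ℝ (deriv φ) t₀)
    (hψ0 : ψ t₀ ≠ 0)
    (Ψ : ℝ → ℝ)
    (hΨ : ∀ t, Ψ t = ψ t / Real.sqrt (ρ^2 * (ψ t)^2 / ν^2 + (φ t)^4 / (l^2 * (ψ t)^2) + 1))
    (u : ℝ → ℝ)
    (hu : ∀ t, u t = deriv ψ t - (2 * (φ t)^3 / l^2) * deriv (fun s => φ s / ψ s) t) :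
    deriv (deriv Ψ) t₀ =
      (deriv (deriv ψ) t₀
          - (6 * (φ t₀)^2 * deriv φ t₀ / l^2) * deriv (fun s => φ s / ψ s) t₀
          - (2 * (φ t₀)^3 / l^2) * deriv (deriv (fun s => φ s / ψ s)) t₀)
        * (Ψ t₀)^3 / (ψ t₀)^3
      - 3 * (deriv ψ t₀ / ψ t₀) * u t₀ * (Ψ t₀)^3 / (ψ t₀)^3
      + 3 * (u t₀)^2 * (Ψ t₀)^5 / (ψ t₀)^6 := by
  have hne : ∀ᶠ t in nhds t₀, ψ t ≠ 0 :=
    hψ.self_of_nhds.continuousAt.eventually_ne hψ0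
  have hq : ∀ᶠ t in nhds t₀, deriv (fun s => φ s / ψ s) t
      = (deriv φ t * ψ t - φ t * deriv ψ t) / (ψ t)^2 := by
    filter_upwards [hψ, hφ, hne] with t h1 h2 h3
    exact (h2.hasDerivAt.fun_div h1.hasDerivAt h3).deriv
  have hd : ∀ᶠ t in nhds t₀, HasDerivAt Ψ (u t * (Ψ t)^3 / (ψ t)^3) t := by
    filter_upwards [hψ, hφ, hne, hq] with t h1 h2 h3 h4
    rw [hu t, h4]
    exact cheeger_first_deriv ρ ν l hν hl ψ φ t _ _ h1.hasDerivAt h2.hasDerivAt h3 Ψ hΨ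
  have hd' : deriv Ψ =ᶠ[nhds t₀] fun t => u t * (Ψ t)^3 / (ψ t)^3 := by
    filter_upwards [hd] with t h using h.deriv
  have hψ1 := hψ.self_of_nhds.hasDerivAt
  have hφ1 := hφ.self_of_nhds.hasDerivAt
  have hqd : DifferentiableAt ℝ (deriv (fun s => φ s / ψ s)) t₀ := by
    have h : DifferentiableAt ℝ
        (fun t => (deriv φ t * ψ t - φ t * deriv ψ t) / (ψ t)^2) t₀ :=
      ((hφ'.fun_mul hψ1.differentiableAt).fun_sub (hφ1.differentiableAt.fun_mul hψ')).fun_div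
        (hψ1.differentiableAt.fun_pow 2) (pow_ne_zero 2 hψ0)
    exact h.congr_of_eventuallyEq hq
  have hud0 := hψ'.hasDerivAt.fun_sub
      ((((hφ1.fun_pow 3).const_mul 2).div_const (l^2)).fun_mul hqd.hasDerivAt)
  have hud := hud0.congr_of_eventuallyEq (Filter.Eventually.of_forall hu)
  have hfin := (hud.fun_mul (hd.self_of_nhds.fun_pow 3)).fun_div (hψ1.fun_pow 3)
    (pow_ne_zero 3 hψ0)
  rw [hd'.deriv_eq, hfin.deriv]
  generalize deriv (deriv (fun s => φ s / ψ s)) t₀ = Q2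
  generalize deriv (fun s => φ s / ψ s) t₀ = Q1
  push_cast
  field_simp
  ring
end

section
/- Let ρ > 0 and M > 0. Let ψ, φ : ℝ → ℝ be continuously differentiable on [0, π/4] with ψ(0) = 0, ψ'(0) = 1, ψ(t) > 0 for t ∈ (0, π/4], and |φ(t)| ≤ M·ψ(t) and |(φ/ψ)'(t)| ≤ M for all t ∈ (0, π/4]. Then for every ε ∈ (0, 1) there exists ν₀ > 0 such that for every ν ∈ (0, ν₀), setting l = ν^{1/3} and Ψ(t) = ψ(t)/√(ρ²ψ(t)²/ν² + φ(t)⁴/(l²ψ(t)²) + 1), one has (Ψ'(t))² ≥ (1 − ε)/(ρ² + 1)³ for every t ∈ (0, ν]. -/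
/-- The final numerical estimate. -/
theorem final_estimate (ρ ε η N D : ℝ) (hε1 : ε < 1) (hη : η = ε / 8) (hη0 : 0 < η)
    (hη1 : η < 1 / 8) (hN' : 1 - η ≤ N) (hD : 0 < D) (hDle : D ≤ (1 + η) * (ρ^2 + 1)) :
    (1 - ε) / (ρ^2 + 1)^3 ≤ (N / Real.sqrt D ^ 3)^2 := by
  have e : (N / Real.sqrt D ^ 3)^2 = N^2 / D^3 := by
    rw [div_pow, ← pow_mul, mul_comm 3 2, pow_mul, Real.sq_sqrt hD.le]
  rw [e]
  have hρ1 : 0 < ρ^2 + 1 := by positivity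
  have hfin : (1 - ε) * (1 + η)^3 ≤ (1 - η)^2 := by
    have : (1 + η)^3 ≤ 1 + 4 * η := by nlinarith [mul_pos hη0 hη0, mul_pos hη0 (mul_pos hη0 hη0)]
    calc (1 - ε) * (1 + η)^3 ≤ (1 - ε) * (1 + 4 * η) := by
          exact mul_le_mul_of_nonneg_left this (by linarith)
      _ ≤ _ := by rw [show ε = 8 * η by linarith]; nlinarith
  rw [div_le_div_iff₀ (by positivity) (by positivity)]
  calc (1 - ε) * D^3 ≤ (1 - ε) * ((1 + η) * (ρ^2 + 1))^3 := by
        exact mul_le_mul_of_nonneg_left (pow_le_pow_left₀ hD.le hDle 3) (by linarith)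
    _ = ((1 - ε) * (1 + η)^3) * (ρ^2 + 1)^3 := by ring
    _ ≤ (1 - η)^2 * (ρ^2 + 1)^3 := by gcongr
    _ ≤ N^2 * (ρ^2 + 1)^3 := by
        have h1 : 0 ≤ 1 - η := by linarith
        have h2 : (1 - η)^2 ≤ N^2 := pow_le_pow_left₀ h1 hN' 2
        exact mul_le_mul_of_nonneg_right h2 (by positivity)

/-- The derivative of the deformed norm, in terms of the quotient q = φ/ψ. -/
theorem deformed_hasDerivAt (ρ ν l t p f : ℝ) (ψ φ q : ℝ → ℝ) (hl : 0 < l)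
    (hψ : HasDerivAt ψ p t) (hq : HasDerivAt q f t)
    (hne : ∀ᶠ s in nhds t, ψ s ≠ 0 ∧ q s = φ s / ψ s) :
    HasDerivAt (fun s => ψ s /
            Real.sqrt (ρ^2 * (ψ s)^2 / ν^2
              + (φ s)^4 / (l^2 * (ψ s)^2) + 1))
      ((p - 2 * (q t)^3 * f * (ψ t)^3 / l^2) /
        Real.sqrt (ρ^2 * (ψ t)^2 / ν^2 + (q t)^4 * (ψ t)^2 / l^2 + 1) ^ 3) t := by
  have hD : 0 < ρ^2 * (ψ t)^2 / ν^2 + (q t)^4 * (ψ t)^2 / l^2 + 1 := by positivity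
  have hs := Real.sqrt_pos.mpr hD
  have hsq := Real.sq_sqrt hD.le
  have key : HasDerivAt (fun s => ρ^2 * (ψ s)^2 / ν^2 + (q s)^4 * (ψ s)^2 / l^2 + 1)
      (ρ^2 * (2 * ψ t * p) / ν^2 + (4 * (q t)^3 * f * (ψ t)^2
        + (q t)^4 * (2 * ψ t * p)) / l^2) t := by
    have h2 := ((hψ.pow 2).const_mul (ρ^2)).div_const (ν^2)
    have h3 := ((hq.pow 4).mul (hψ.pow 2)).div_const (l^2)
    refine ((h2.add h3).add_const 1).congr_deriv ?_
    simp
  have h := hψ.div (key.sqrt hD.ne') hs.ne'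
  have h' := h.congr_of_eventuallyEq (f₁ := fun s => ψ s /
            Real.sqrt (ρ^2 * (ψ s)^2 / ν^2
              + (φ s)^4 / (l^2 * (ψ s)^2) + 1)) (by
    filter_upwards [hne] with s hs
    obtain ⟨h1, h2⟩ := hs
    have : (φ s)^4 / (l^2 * (ψ s)^2) = (q s)^4 * (ψ s)^2 / l^2 := by
      rw [h2]; field_simp
    simp only [this, Pi.div_apply])
  refine h'.congr_deriv ?_
  set S := Real.sqrt (ρ^2 * (ψ t)^2 / ν^2 + (q t)^4 * (ψ t)^2 / l^2 + 1) with hS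
  rw [div_eq_div_iff (by positivity) (by positivity)]
  have e : p * S - ψ t * ((ρ^2 * (2 * ψ t * p) / ν^2 + (4 * (q t)^3 * f * (ψ t)^2
        + (q t)^4 * (2 * ψ t * p)) / l^2) / (2 * S))
      = (p - 2 * (q t)^3 * f * (ψ t)^3 / l^2) / S := by
    rw [eq_div_iff hs.ne']
    have : (p * S - ψ t * ((ρ^2 * (2 * ψ t * p) / ν^2 + (4 * (q t)^3 * f * (ψ t)^2
        + (q t)^4 * (2 * ψ t * p)) / l^2) / (2 * S))) * S
      = p * S^2 - ψ t * ((ρ^2 * (2 * ψ t * p) / ν^2 + (4 * (q t)^3 * f * (ψ t)^2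
        + (q t)^4 * (2 * ψ t * p)) / l^2) / 2) := by
      field_simp
    rw [this, hsq]
    ring
  rw [e]
  field_simp

/-- Proposition 7.4 ('Compression of psi prime'), lower bound: on the small
interval (0, ν] the derivative of the Cheeger-deformed norm
Ψ = ψ/√(ρ²ψ²/ν² + φ⁴/(l²ψ²) + 1), with l = ν^{1/3}, satisfies
(Ψ')² ≥ (1 − ε)/(ρ² + 1)³ once ν is small enough. -/
theorem compression_lower_bound (ρ M : ℝ) (hρ : 0 < ρ) (hM : 0 < M)
    (ψ ψ' φ φ' : ℝ → ℝ)
    (hψ : ∀ t ∈ Set.Icc (0:ℝ) (Real.pi/4), HasDerivAt ψ (ψ' t) t)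
    (hψ'c : ContinuousOn ψ' (Set.Icc 0 (Real.pi/4)))
    (hφ : ∀ t ∈ Set.Icc (0:ℝ) (Real.pi/4), HasDerivAt φ (φ' t) t)
    (hφ'c : ContinuousOn φ' (Set.Icc 0 (Real.pi/4)))
    (h0 : ψ 0 = 0) (h1 : ψ' 0 = 1)
    (hpos : ∀ t ∈ Set.Ioc (0:ℝ) (Real.pi/4), 0 < ψ t)
    (hφb : ∀ t ∈ Set.Ioc (0:ℝ) (Real.pi/4), |φ t| ≤ M * ψ t)
    (hq : ∀ t ∈ Set.Ioc (0:ℝ) (Real.pi/4), |deriv (fun s => φ s / ψ s) t| ≤ M) :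
    ∀ ε ∈ Set.Ioo (0:ℝ) 1, ∃ ν₀ : ℝ, 0 < ν₀ ∧
      ∀ ν ∈ Set.Ioo (0:ℝ) ν₀, ∀ t ∈ Set.Ioc (0:ℝ) ν,
        (1 - ε) / (ρ^2 + 1)^3 ≤
          (deriv (fun s => ψ s /
            Real.sqrt (ρ^2 * (ψ s)^2 / ν^2
              + (φ s)^4 / ((ν ^ ((1:ℝ)/3))^2 * (ψ s)^2) + 1)) t)^2 := by
  intro ε ⟨hε0, hε1⟩
  obtain ⟨η, hη⟩ : ∃ η, η = ε / 8 := ⟨_, rfl⟩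
  have hη0 : 0 < η := by linarith
  have hη1 : η < 1 / 8 := by linarith
  have hpi : 0 < Real.pi / 4 := by positivity
  have hz : (0:ℝ) ∈ Set.Icc (0:ℝ) (Real.pi/4) := ⟨le_rfl, hpi.le⟩
  -- radius for ψ
  have ha := (hasDerivAt_iff_isLittleO.mp (hψ 0 hz)).def (c := η / 3) (by positivity)
  obtain ⟨r, hr, hr'⟩ := Metric.eventually_nhds_iff.mp ha
  obtain ⟨r2, hr2, hr2'⟩ := Metric.continuousOn_iff.mp hψ'c 0 hz (η / 3) (by positivity)
  have hM4 : 0 < M ^ 4 := by positivity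
  refine ⟨min (min r r2) (min (min 1 (Real.pi / 4)) (η / (32 * M ^ 4))), by positivity, ?_⟩
  rintro ν ⟨hν0, hν⟩ t ⟨ht0, htν⟩
  simp only [lt_min_iff] at hν
  obtain ⟨⟨hνr, hνr2⟩, ⟨hν1, hνpi⟩, hνM⟩ := hν
  rw [lt_div_iff₀ (by positivity)] at hνM
  have htI : t ∈ Set.Ioc (0:ℝ) (Real.pi/4) := ⟨ht0, by linarith⟩
  have htI' := Set.Ioc_subset_Icc_self htI
  have hψt := hpos t htI
  have hψle : ψ t ≤ (1 + η / 3) * t := by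
    have := hr' (y := t) (by rw [Real.dist_eq, sub_zero, abs_of_pos ht0]; linarith)
    simp only [h0, h1, sub_zero, smul_eq_mul, mul_one, Real.norm_eq_abs, abs_of_pos ht0] at this
    linarith [(abs_le.mp this).2]
  have hψ'l : 1 - η / 3 ≤ ψ' t := by
    have := hr2' t htI' (by rw [Real.dist_eq, sub_zero, abs_of_pos ht0]; linarith)
    rw [Real.dist_eq, h1] at this
    linarith [(abs_lt.mp this).1]
  have hl0 : 0 < ν ^ ((1:ℝ)/3) := by positivity
  have hl2 : ν ≤ (ν ^ ((1:ℝ)/3))^2 := by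
    rw [← Real.rpow_natCast, ← Real.rpow_mul hν0.le]
    calc ν = ν ^ (1:ℝ) := (Real.rpow_one ν).symm
      _ ≤ _ := Real.rpow_le_rpow_of_exponent_ge hν0 hν1.le (by norm_num)
  generalize ν ^ ((1:ℝ)/3) = l at hl0 hl2 ⊢
  have hqd : DifferentiableAt ℝ (fun s => φ s / ψ s) t :=
    (hφ t htI').differentiableAt.div (hψ t htI').differentiableAt hψt.ne'
  have hne : ∀ᶠ s in nhds t, ψ s ≠ 0 ∧ (fun s => φ s / ψ s) s = φ s / ψ s := by
    filter_upwards [(hψ t htI').continuousAt.eventually_ne hψt.ne'] with s hs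
    exact ⟨hs, rfl⟩
  rw [(deformed_hasDerivAt ρ ν l t _ _ ψ φ _ hl0 (hψ t htI') hqd.hasDerivAt hne).deriv]
  have hf := hq t htI
  have hqb : |φ t / ψ t| ≤ M := by
    rw [abs_div, abs_of_pos hψt, div_le_iff₀ hψt]; exact hφb t htI
  generalize deriv (fun s => φ s / ψ s) t = f at hf ⊢
  generalize φ t / ψ t = q at hqb ⊢
  generalize ψ' t = p at hψ'l ⊢
  generalize ψ t = x at hψt hψle ⊢
  have hxν : x ≤ (1 + η / 3) * ν := hψle.trans (by gcongr)
  have hx2 : x ≤ 2 * ν := hxν.trans (by gcongr; linarith)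
  have hxl : x^2 / l^2 ≤ 4 * ν := by
    rw [div_le_iff₀ (by positivity)]
    calc x^2 ≤ (2 * ν)^2 := by gcongr
      _ = 4 * ν * ν := by ring
      _ ≤ _ := by gcongr
  have hq4 : q^4 ≤ M^4 := by
    rw [← (show Even 4 by decide).pow_abs q]; gcongr
  have hN : |2 * q^3 * f * x^3 / l^2| ≤ η / 2 := by
    have e : |2 * q^3 * f * x^3 / l^2| = 2 * |q|^3 * |f| * (x * (x^2 / l^2)) := by
      rw [abs_div, abs_mul, abs_mul, abs_mul, abs_pow, abs_pow, abs_pow, abs_of_pos hψt,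
        abs_of_pos hl0, abs_two]
      ring
    rw [e]
    calc 2 * |q|^3 * |f| * (x * (x^2 / l^2)) ≤ 2 * M^3 * M * ((2 * ν) * (4 * ν)) := by gcongr
      _ = (ν * (32 * M^4)) * ν / 2 := by ring
      _ ≤ η * 1 / 2 := by gcongr
      _ = η / 2 := by ring
  have hN' : 1 - η ≤ p - 2 * q^3 * f * x^3 / l^2 := by
    linarith [(abs_le.mp hN).2]
  have hD : 0 < ρ^2 * x^2 / ν^2 + q^4 * x^2 / l^2 + 1 := by positivity
  have hDle : ρ^2 * x^2 / ν^2 + q^4 * x^2 / l^2 + 1 ≤ (1 + η) * (ρ^2 + 1) := by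
    have a1 : ρ^2 * x^2 / ν^2 ≤ ρ^2 * (1 + η) := by
      rw [div_le_iff₀ (by positivity)]
      calc ρ^2 * x^2 ≤ ρ^2 * ((1 + η / 3) * ν)^2 := by gcongr
        _ = ρ^2 * (1 + η / 3)^2 * ν^2 := by ring
        _ ≤ _ := by gcongr; nlinarith
    have a2 : q^4 * x^2 / l^2 ≤ η := by
      rw [mul_div_assoc]
      calc q^4 * (x^2 / l^2) ≤ M^4 * (4 * ν) := by gcongr
        _ ≤ η := by nlinarith [mul_pos hν0 hM4]
    linarith
  generalize p - 2 * q^3 * f * x^3 / l^2 = N at hN' ⊢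
  generalize ρ^2 * x^2 / ν^2 + q^4 * x^2 / l^2 + 1 = D at hD hDle ⊢
  exact final_estimate ρ ε η N D hε1 hη hη0 hη1 hN' hD hDle
end

section
/- Let c > 0 and let ψ : ℝ → ℝ be twice continuously differentiable on [0, π/4] with ψ(0) = 0, ψ'(0) = 1, ψ'(π/4) = 0, and ψ(t)² ≤ c² for all t ∈ [0, π/4]. Then ∫₀^{π/4} [ (ψ'(t))² + (ψ(t)²/c²)(ψ'(t))² + (ψ(t)²/c²)·(ψψ')'(t) ] dt > 0, where (ψψ')'(t) = (ψ'(t))² + ψ(t)ψ''(t). -/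
/-- Integral positivity at the end of Subsection 4.1: with ψ twice continuously
differentiable on [0, π/4], ψ(0) = 0, ψ'(0) = 1, ψ'(π/4) = 0, ψ² ≤ c²,
∫₀^{π/4} [(ψ')² + (ψ²/c²)(ψ')² + (ψ²/c²)(ψψ')'] > 0. -/
theorem integral_curvature_terms_pos (c : ℝ) (hc : 0 < c) (ψ ψ' ψ'' : ℝ → ℝ)
    (hψ : ∀ t ∈ Set.Icc (0:ℝ) (Real.pi/4), HasDerivAt ψ (ψ' t) t)
    (hψ' : ∀ t ∈ Set.Icc (0:ℝ) (Real.pi/4), HasDerivAt ψ' (ψ'' t) t)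
    (hcont : ContinuousOn ψ'' (Set.Icc 0 (Real.pi/4)))
    (h0 : ψ 0 = 0) (h1 : ψ' 0 = 1) (h2 : ψ' (Real.pi/4) = 0)
    (hb : ∀ t ∈ Set.Icc (0:ℝ) (Real.pi/4), (ψ t)^2 ≤ c^2) :
    0 < ∫ t in (0:ℝ)..(Real.pi/4),
      ((ψ' t)^2 + ((ψ t)^2 / c^2) * (ψ' t)^2
        + ((ψ t)^2 / c^2) * ((ψ' t)^2 + ψ t * ψ'' t)) := by
  have hpi : (0:ℝ) < Real.pi/4 := by positivity
  have hu : Set.uIcc (0:ℝ) (Real.pi/4) = Set.Icc 0 (Real.pi/4) := Set.uIcc_of_le hpi.le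
  have c0 : ContinuousOn ψ (Set.Icc 0 (Real.pi/4)) :=
    fun t ht => (hψ t ht).continuousAt.continuousWithinAt
  have c1 : ContinuousOn ψ' (Set.Icc 0 (Real.pi/4)) :=
    fun t ht => (hψ' t ht).continuousAt.continuousWithinAt
  have cf : ContinuousOn (fun t => (ψ' t)^2 * (1 - (ψ t)^2 / c^2)) (Set.Icc 0 (Real.pi/4)) := by
    fun_prop
  have cg : ContinuousOn (fun t => (3 * (ψ t)^2 * ψ' t * ψ' t + (ψ t)^3 * ψ'' t) / c^2)
      (Set.Icc 0 (Real.pi/4)) := by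
    fun_prop
  have iF : IntervalIntegrable (fun t => (ψ' t)^2 * (1 - (ψ t)^2 / c^2))
      MeasureTheory.volume 0 (Real.pi/4) := ContinuousOn.intervalIntegrable (by rwa [hu])
  have iG : IntervalIntegrable (fun t => (3 * (ψ t)^2 * ψ' t * ψ' t + (ψ t)^3 * ψ'' t) / c^2)
      MeasureTheory.volume 0 (Real.pi/4) := ContinuousOn.intervalIntegrable (by rwa [hu])
  have hG : ∫ t in (0:ℝ)..(Real.pi/4),
      (3 * (ψ t)^2 * ψ' t * ψ' t + (ψ t)^3 * ψ'' t) / c^2 = 0 := by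
    rw [intervalIntegral.integral_eq_sub_of_hasDerivAt
      (f := fun t => (ψ t)^3 * ψ' t / c^2) _ iG]
    · simp [h0, h2]
    · intro t ht
      rw [hu] at ht
      have := (((hψ t ht).pow 3).mul (hψ' t ht)).div_const (c^2)
      simpa using this
  have hF : 0 < ∫ t in (0:ℝ)..(Real.pi/4), (ψ' t)^2 * (1 - (ψ t)^2 / c^2) := by
    apply intervalIntegral.integral_pos hpi cf
    · intro t ht
      have h3 : (ψ t)^2 / c^2 ≤ 1 :=
        div_le_one_of_le₀ (hb t (Set.Ioc_subset_Icc_self ht)) (by positivity)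
      exact mul_nonneg (sq_nonneg _) (by linarith)
    · exact ⟨0, ⟨le_rfl, hpi.le⟩, by simp [h0, h1]⟩
  have key : ∫ t in (0:ℝ)..(Real.pi/4),
      ((ψ' t)^2 + ((ψ t)^2 / c^2) * (ψ' t)^2
        + ((ψ t)^2 / c^2) * ((ψ' t)^2 + ψ t * ψ'' t))
      = (∫ t in (0:ℝ)..(Real.pi/4), (ψ' t)^2 * (1 - (ψ t)^2 / c^2)) +
        ∫ t in (0:ℝ)..(Real.pi/4),
          (3 * (ψ t)^2 * ψ' t * ψ' t + (ψ t)^3 * ψ'' t) / c^2 := by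
    rw [← intervalIntegral.integral_add iF iG]
    congr 1
    funext t
    ring
  rw [key, hG, add_zero]
  exact hF
end

section
/- Let c > 0 and let ψ : ℝ → ℝ be twice continuously differentiable on [0, π/4] with ψ(0) = 0, ψ'(0) = 1, ψ'(π/4) = 0, and ψ(t)² ≤ c² for all t ∈ [0, π/4]. Then there exists a twice continuously differentiable function I : ℝ → ℝ with I'(0) = 0 and I'(π/4) = 0 such that (ψ'(t))² + (ψ(t)²/c²)(ψ'(t))² + (ψ(t)²/c²)·(ψψ')'(t) − I''(t)·c² > 0 for every t ∈ [0, π/4], where (ψψ')'(t) = (ψ'(t))² + ψ(t)ψ''(t). -/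
/-- Pointwise positivity conclusion of Subsection 4.1: there is a C² function I
with I'(0) = I'(π/4) = 0 such that
(ψ')² + (ψ²/c²)(ψ')² + (ψ²/c²)(ψψ')' − I'' c² > 0 on [0, π/4]. -/
theorem exists_I_pointwise_positive (c : ℝ) (hc : 0 < c) (ψ ψ' ψ'' : ℝ → ℝ)
    (hψ : ∀ t ∈ Set.Icc (0:ℝ) (Real.pi/4), HasDerivAt ψ (ψ' t) t)
    (hψ' : ∀ t ∈ Set.Icc (0:ℝ) (Real.pi/4), HasDerivAt ψ' (ψ'' t) t)
    (hcont : ContinuousOn ψ'' (Set.Icc 0 (Real.pi/4)))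
    (h0 : ψ 0 = 0) (h1 : ψ' 0 = 1) (h2 : ψ' (Real.pi/4) = 0)
    (hb : ∀ t ∈ Set.Icc (0:ℝ) (Real.pi/4), (ψ t)^2 ≤ c^2) :
    ∃ I : ℝ → ℝ, ContDiff ℝ 2 I ∧ deriv I 0 = 0 ∧ deriv I (Real.pi/4) = 0 ∧
      ∀ t ∈ Set.Icc (0:ℝ) (Real.pi/4),
        0 < (ψ' t)^2 + ((ψ t)^2 / c^2) * (ψ' t)^2
          + ((ψ t)^2 / c^2) * ((ψ' t)^2 + ψ t * ψ'' t)
          - deriv (deriv I) t * c^2 := by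
  have hL : (0:ℝ) < Real.pi / 4 := by positivity
  set L := Real.pi / 4 with hLdef
  have hc0 : c ≠ 0 := hc.ne'
  have cψ : ContinuousOn ψ (Set.Icc 0 L) := fun t ht => (hψ t ht).continuousAt.continuousWithinAt
  have cψ' : ContinuousOn ψ' (Set.Icc 0 L) :=
    fun t ht => (hψ' t ht).continuousAt.continuousWithinAt
  obtain ⟨F, hF⟩ : ∃ F : ℝ → ℝ, F = fun t => (ψ' t)^2 + ((ψ t)^2 / c^2) * (ψ' t)^2
          + ((ψ t)^2 / c^2) * ((ψ' t)^2 + ψ t * ψ'' t) := ⟨_, rfl⟩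
  have cF : ContinuousOn F (Set.Icc 0 L) := by rw [hF]; fun_prop
  obtain ⟨P, hP⟩ : ∃ P : ℝ → ℝ, P = fun t => (ψ' t)^2 * (1 - (ψ t)^2 / c^2) := ⟨_, rfl⟩
  have cP : ContinuousOn P (Set.Icc 0 L) := by rw [hP]; fun_prop
  have hu : Set.uIcc 0 L = Set.Icc 0 L := Set.uIcc_of_le hL.le
  have iF : IntervalIntegrable F MeasureTheory.volume 0 L :=
    ContinuousOn.intervalIntegrable (by rwa [hu])
  have iP : IntervalIntegrable P MeasureTheory.volume 0 L :=
    ContinuousOn.intervalIntegrable (by rwa [hu])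
  have hP0 : 0 < ∫ t in (0:ℝ)..L, P t := by
    refine intervalIntegral.integral_pos hL cP ?_ ⟨0, ⟨le_rfl, hL.le⟩, ?_⟩
    · intro t ht
      have := hb t ⟨ht.1.le, ht.2⟩
      have h3 : (ψ t)^2 / c^2 ≤ 1 := by rw [div_le_one (by positivity)]; exact this
      rw [hP]
      exact mul_nonneg (sq_nonneg _) (by linarith)
    · simp [hP, h0, h1]
  have hdiff : ∫ t in (0:ℝ)..L, (F t - P t) = 0 := by
    rw [intervalIntegral.integral_eq_sub_of_hasDerivAt
      (f := fun t => (ψ t)^3 * ψ' t / c^2) ?_ (iF.sub iP)]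
    · simp [h0, h2]
    · intro t ht
      rw [hu] at ht
      have h := ((((hψ t ht).pow 3).mul (hψ' t ht)).div_const (c^2))
      refine h.congr_deriv ?_
      simp only [hF, hP, Pi.pow_apply]
      field_simp
      push_cast
      ring
  rw [intervalIntegral.integral_sub iF iP] at hdiff
  have hFpos : 0 < ∫ t in (0:ℝ)..L, F t := by linarith
  obtain ⟨m, hm⟩ : ∃ m, m = (∫ t in (0:ℝ)..L, F t) / L := ⟨_, rfl⟩
  have hmpos : 0 < m := by rw [hm]; positivity
  obtain ⟨E, hE⟩ : ∃ E : ℝ → ℝ, E = Set.IccExtend hL.le (Set.restrict (Set.Icc 0 L) F) := ⟨_, rfl⟩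
  have cE : Continuous E := by
    rw [hE]; exact (continuousOn_iff_continuous_restrict.1 cF).Icc_extend'
  have hEF : ∀ t ∈ Set.Icc 0 L, E t = F t := by
    intro t ht
    rw [hE, Set.IccExtend_of_mem _ _ ht]; rfl
  obtain ⟨g, hg⟩ : ∃ g : ℝ → ℝ, g = fun t => (E t - m) / c^2 := ⟨_, rfl⟩
  have cg : Continuous g := by rw [hg]; fun_prop
  obtain ⟨J, hJ⟩ : ∃ J : ℝ → ℝ, J = fun t => ∫ x in (0:ℝ)..t, g x := ⟨_, rfl⟩
  have dJ : ∀ t, HasDerivAt J (g t) t := by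
    intro t; rw [hJ]; exact cg.integral_hasStrictDerivAt 0 t |>.hasDerivAt
  have cJ : Continuous J := continuous_iff_continuousAt.2 fun t => (dJ t).continuousAt
  obtain ⟨I, hI⟩ : ∃ I : ℝ → ℝ, I = fun t => ∫ x in (0:ℝ)..t, J x := ⟨_, rfl⟩
  have dI : ∀ t, HasDerivAt I (J t) t := by
    intro t; rw [hI]; exact cJ.integral_hasStrictDerivAt 0 t |>.hasDerivAt
  have eI : deriv I = J := funext fun t => (dI t).deriv
  have eJ : deriv J = g := funext fun t => (dJ t).deriv
  have C1 : ContDiff ℝ 1 J :=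
    contDiff_one_iff_deriv.2 ⟨fun t => (dJ t).differentiableAt, by rwa [eJ]⟩
  refine ⟨I, ?_, ?_, ?_, ?_⟩
  · rw [show (2 : WithTop ℕ∞) = 1 + 1 by norm_num, contDiff_succ_iff_deriv]
    exact ⟨fun t => (dI t).differentiableAt, by simp, by rwa [eI]⟩
  · rw [eI, hJ]; simp
  · rw [eI, hJ]
    have : ∫ x in (0:ℝ)..L, E x = ∫ x in (0:ℝ)..L, F x :=
      intervalIntegral.integral_congr (by rw [hu]; exact hEF)
    simp only [hg]
    rw [intervalIntegral.integral_div, intervalIntegral.integral_sub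
      (cE.intervalIntegrable _ _) (by simp), this, intervalIntegral.integral_const, hm]
    have hL0 : L ≠ 0 := hL.ne'
    simp only [smul_eq_mul, sub_zero]
    rw [mul_div_cancel₀ _ hL0]
    simp
  · intro t ht
    rw [eI, eJ]
    have h4 : g t * c^2 = F t - m := by
      rw [hg]; simp only [hEF t ht]; field_simp
    rw [h4]
    simp only [hF]
    linarith
end
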